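/- Let γ, γ̃ ∈ ℂ with 0 < Re(γ + γ̃) < 1/2. Then the limit as R → ∞ of ∫₀^{R} ∫₀^{2π} r^{γ+γ̃−1} e^{i(γ−γ̃)θ} e^{2ir·cos θ} dθ dr exists in ℂ. (Equivalently, the two-dimensional Fourier-type integral ∬ t^{γ−1} t̄^{γ̃−1} e^{i(t+t̄)} d²t, written in polar coordinates t = re^{iθ} with the branch 0 ≤ arg t < 2π, converges as an improper integral over expanding disks.) -/

import Mathlib

open Real MeasureTheory Filter Topology

/-- The truncated oscillatory Mellin integral `∫₀^X r^{s-1} e^{iσr} dr`. -/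
noncomputable def oscMellin (s : ℂ) (σ X : ℝ) : ℂ :=
  ∫ r in (0 : ℝ)..X, (r : ℂ) ^ (s - 1) * Complex.exp (Complex.I * σ * r)

lemma intervalIntegrable_cpow_mul_exp {s : ℂ} (hs : 0 < s.re) (σ a b : ℝ) :
    IntervalIntegrable
      (fun r : ℝ => (r : ℂ) ^ (s - 1) * Complex.exp (Complex.I * σ * r)) volume a b :=
  (intervalIntegral.intervalIntegrable_cpow' (by simpa using hs)).mul_continuousOn
    (by fun_prop)

lemma tendsto_cpow_mul_exp_atTop {s : ℂ} (hs : s.re < 0) (σ : ℝ) :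
    Tendsto (fun r : ℝ => (r : ℂ) ^ s * Complex.exp (Complex.I * σ * r)) atTop (𝓝 0) := by
  rw [tendsto_zero_iff_norm_tendsto_zero]
  have h := tendsto_rpow_neg_atTop (y := -s.re) (by linarith)
  refine h.congr' ?_
  filter_upwards [eventually_gt_atTop 0] with r hr
  rw [norm_mul, Complex.norm_cpow_eq_rpow_re_of_pos hr, Complex.norm_exp]
  simp

lemma exists_tendsto_oscMellin {s : ℂ} (hs : 0 < s.re) (hs' : s.re < 1) {σ : ℝ} (hσ : σ ≠ 0) :
    ∃ L : ℂ, Tendsto (oscMellin s σ) atTop (𝓝 L) := by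
  have hσc : Complex.I * (σ : ℂ) ≠ 0 := by simp [hσ]
  set e : ℝ → ℂ := fun r => Complex.exp (Complex.I * σ * r) / (Complex.I * σ) with he
  have hint : IntegrableOn (fun r : ℝ => (s - 1) * (r : ℂ) ^ (s - 1 - 1) * e r) (Set.Ioi 1) := by
    have h := (integrableOn_Ioi_cpow_of_lt (a := s - 1 - 1) (by simp; linarith)
      zero_lt_one).const_mul (s - 1)
    refine h.mul_bdd (c := ‖Complex.I * (σ : ℂ)‖⁻¹) (by fun_prop) (.of_forall fun r => ?_)
    rw [he]
    simp [Complex.norm_exp]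
  have hlim := intervalIntegral_tendsto_integral_Ioi 1 hint tendsto_id
  have hbd : Tendsto (fun X : ℝ => (X : ℂ) ^ (s - 1) * e X) atTop (𝓝 0) := by
    have h := (tendsto_cpow_mul_exp_atTop (s := s - 1) (by simpa using hs') σ).div_const
      (Complex.I * σ)
    simpa [he, mul_div_assoc] using h
  refine ⟨_, (((hbd.sub_const (((1 : ℝ) : ℂ) ^ (s - 1) * e 1)).sub hlim).const_add
    (oscMellin s σ 1)).congr' ?_⟩
  filter_upwards [eventually_ge_atTop 1] with X hX
  have hpos : ∀ x ∈ Set.uIcc 1 X, x ≠ 0 := fun x hx => by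
    rw [Set.uIcc_of_le hX] at hx
    linarith [hx.1]
  have hparts := intervalIntegral.integral_mul_deriv_eq_deriv_mul (a := 1) (b := X)
    (u := fun r : ℝ => (r : ℂ) ^ (s - 1)) (u' := fun r : ℝ => (s - 1) * (r : ℂ) ^ (s - 1 - 1))
    (v := e) (v' := fun r => Complex.exp (Complex.I * σ * r))
    (fun x hx => ?_) (fun x _ => ?_) ?_ (Continuous.intervalIntegrable (by fun_prop) _ _)
  · rw [oscMellin, oscMellin, ← intervalIntegral.integral_add_adjacent_intervals
      (intervalIntegrable_cpow_mul_exp hs σ 0 1) (intervalIntegrable_cpow_mul_exp hs σ 1 X),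
      hparts]
    simp
  · have h0 : (x : ℂ) ∈ Complex.slitPlane := by
      rw [Set.uIcc_of_le hX] at hx
      exact Complex.ofReal_mem_slitPlane.2 (by linarith [hx.1])
    exact ((hasDerivAt_id (x : ℂ)).cpow_const (c := s - 1) h0).comp_ofReal.congr_deriv (by simp)
  · have h := ((((hasDerivAt_id (x : ℂ)).const_mul (Complex.I * σ)).cexp).div_const
      (Complex.I * σ)).comp_ofReal
    refine h.congr_deriv ?_
    simp only [id, mul_one]
    exact mul_div_cancel_right₀ _ hσc
  · refine ContinuousOn.intervalIntegrable fun x hx => ?_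
    exact ((Complex.continuousAt_ofReal_cpow_const _ _ (Or.inr (hpos x hx))).const_mul
      _).continuousWithinAt

lemma exists_norm_oscMellin_le {s : ℂ} (hs : 0 < s.re) (hs' : s.re < 1) {σ : ℝ} (hσ : σ ≠ 0) :
    ∃ C : ℝ, ∀ X, 0 ≤ X → ‖oscMellin s σ X‖ ≤ C := by
  obtain ⟨L, hL⟩ := exists_tendsto_oscMellin hs hs' hσ
  have hev : ∀ᶠ X in atTop, ‖oscMellin s σ X‖ < ‖L‖ + 1 :=
    hL.norm.eventually_lt_const (lt_add_one _)
  obtain ⟨N, hN⟩ := eventually_atTop.1 hev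
  have hcont : Continuous (oscMellin s σ) :=
    intervalIntegral.continuous_primitive (intervalIntegrable_cpow_mul_exp hs σ) 0
  obtain ⟨C, hC⟩ := (isCompact_Icc (a := 0) (b := N)).exists_bound_of_continuousOn
    hcont.continuousOn
  refine ⟨max C (‖L‖ + 1), fun X hX => ?_⟩
  rcases le_total X N with h | h
  · exact (hC X ⟨hX, h⟩).trans (le_max_left _ _)
  · exact (hN X h).le.trans (le_max_right _ _)

lemma oscMellin_mul {s : ℂ} {c : ℝ} (hc : 0 < c) (σ : ℝ) {X : ℝ} (hX : 0 ≤ X) :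
    oscMellin s σ (c * X) = (c : ℂ) ^ s * oscMellin s (c * σ) X := by
  have hc' : (c : ℂ) ≠ 0 := by exact_mod_cast hc.ne'
  rw [oscMellin, ← mul_zero c, ← intervalIntegral.smul_integral_comp_mul_left,
    oscMellin, ← intervalIntegral.integral_const_mul, ← intervalIntegral.integral_smul]
  refine intervalIntegral.integral_congr fun r hr => ?_
  rw [Set.uIcc_of_le hX] at hr
  simp only [Complex.ofReal_mul, Complex.real_smul]
  rw [Complex.mul_cpow_ofReal_nonneg hc.le hr.1, Complex.cpow_sub _ _ hc', Complex.cpow_one]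
  field_simp

/-- By scaling, the truncated integrals are `O(|σ|^{-Re s})` uniformly in the truncation. -/
lemma exists_norm_oscMellin_le_rpow {s : ℂ} (hs : 0 < s.re) (hs' : s.re < 1) :
    ∃ C : ℝ, ∀ σ, σ ≠ 0 → ∀ X, 0 ≤ X → ‖oscMellin s σ X‖ ≤ C * |σ| ^ (-s.re) := by
  obtain ⟨C₁, hC₁⟩ := exists_norm_oscMellin_le hs hs' one_ne_zero
  obtain ⟨C₂, hC₂⟩ := exists_norm_oscMellin_le hs hs' (neg_ne_zero.2 one_ne_zero)
  refine ⟨max C₁ C₂, fun σ hσ X hX => ?_⟩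
  have hpos : 0 < |σ| := abs_pos.2 hσ
  have key : ∀ τ : ℝ, |σ| * τ = σ →
      ‖oscMellin s σ X‖ = ‖oscMellin s τ (|σ| * X)‖ * |σ| ^ (-s.re) := fun τ hτ => by
    rw [oscMellin_mul hpos τ hX, hτ, norm_mul, Complex.norm_cpow_eq_rpow_re_of_pos hpos,
      mul_right_comm, ← rpow_add hpos]
    simp
  have hX' : 0 ≤ |σ| * X := by positivity
  rcases lt_or_gt_of_ne hσ with h | h
  · rw [key (-1) (by rw [abs_of_neg h]; ring)]
    gcongr
    exact (hC₂ _ hX').trans (le_max_right _ _)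
  · rw [key 1 (by rw [abs_of_pos h]; ring)]
    gcongr
    exact (hC₁ _ hX').trans (le_max_left _ _)

lemma intervalIntegrable_abs_cos_rpow {a : ℝ} (ha : 0 ≤ a) (ha' : a < 1) (b c : ℝ) :
    IntervalIntegrable (fun θ => |cos θ| ^ (-a)) volume b c := by
  have hper : Function.Periodic (fun θ => |sin θ| ^ (-a)) π := fun θ => by simp [sin_add_pi]
  have habs : IntervalIntegrable (fun x : ℝ => |x| ^ (-a)) volume (-(π / 2)) (π / 2) := by
    have h := (intervalIntegral.intervalIntegrable_cpow' (a := -(π / 2)) (b := π / 2)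
      (r := ((-a : ℝ) : ℂ)) (by simpa using ha')).norm
    simpa only [Complex.norm_cpow_real, Complex.norm_real, norm_eq_abs] using h
  have hsin : IntervalIntegrable (fun θ => |sin θ| ^ (-a)) volume (-(π / 2)) (π / 2) := by
    refine (habs.const_mul ((2 / π) ^ (-a))).mono_fun
      (Measurable.aestronglyMeasurable (by fun_prop)) ?_
    have hle : -(π / 2) ≤ π / 2 := by linarith [pi_pos]
    rw [Set.uIoc_of_le hle]
    filter_upwards [ae_restrict_mem measurableSet_Ioc, ae_restrict_of_ae (Measure.ae_ne volume 0)]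
      with x hx hx0
    rw [norm_of_nonneg (by positivity), norm_of_nonneg (by positivity),
      ← mul_rpow (by positivity) (by positivity)]
    refine rpow_le_rpow_of_nonpos ?_ (mul_abs_le_abs_sin (abs_le.2 ⟨hx.1.le, hx.2⟩)) (by linarith)
    have := abs_pos.2 hx0
    positivity
  have hall : ∀ b c, IntervalIntegrable (fun θ => |sin θ| ^ (-a)) volume b c :=
    hper.intervalIntegrable pi_ne_zero (t := -(π / 2)) (by convert hsin using 1; ring)
  have h := (hall (b + π / 2) (c + π / 2)).comp_add_right (π / 2)
  simpa [sin_add_pi_div_two] using h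

/-- For γ, γ̃ ∈ ℂ with 0 < Re(γ+γ̃) < 1/2, the improper integral
∫₀^R ∫₀^{2π} r^{γ+γ̃−1} e^{i(γ−γ̃)θ} e^{2ir cos θ} dθ dr converges as R → ∞. -/
theorem stmt_4 (γ γt : ℂ) (h₁ : 0 < (γ + γt).re) (h₂ : (γ + γt).re < 1 / 2) :
    ∃ L : ℂ, Tendsto
      (fun R : ℝ => ∫ r in (0:ℝ)..R, ∫ θ in (0:ℝ)..(2 * π),
        (r : ℂ) ^ (γ + γt - 1) *
          Complex.exp (Complex.I * (γ - γt) * (θ : ℂ)) *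
          Complex.exp (2 * Complex.I * (r : ℂ) * (Real.cos θ : ℂ)))
      atTop (𝓝 L) := by
  have h₂' : (γ + γt).re < 1 := by linarith
  set s := γ + γt
  set g : ℝ → ℂ := fun θ => Complex.exp (Complex.I * (γ - γt) * (θ : ℂ))
  have hgc : Continuous g := by fun_prop
  obtain ⟨M, hM⟩ := (isCompact_Icc (a := 0) (b := 2 * π)).exists_bound_of_continuousOn
    hgc.continuousOn
  obtain ⟨C, hC⟩ := exists_norm_oscMellin_le_rpow h₁ h₂'
  have hpi : 0 ≤ 2 * π := by positivity
  have hcos : ∀ᵐ θ : ℝ, cos θ ≠ 0 := by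
    have hcount : (Set.range fun k : ℤ => (2 * k + 1) * π / 2).Countable := Set.countable_range _
    filter_upwards [hcount.ae_notMem volume] with θ hθ h0
    obtain ⟨k, hk⟩ := cos_eq_zero_iff.1 h0
    exact hθ ⟨k, hk.symm⟩
  choose! L hL using fun (σ : ℝ) (hσ : σ ≠ 0) => exists_tendsto_oscMellin h₁ h₂' hσ
  have hexp : ∀ r θ : ℝ, Complex.exp (2 * Complex.I * (r : ℂ) * (Real.cos θ : ℂ)) =
      Complex.exp (Complex.I * ((2 * cos θ : ℝ) : ℂ) * r) := fun r θ => by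
    congr 1
    push_cast
    ring
  have hint : ∀ R, IntegrableOn (Function.uncurry fun r θ : ℝ => (r : ℂ) ^ (s - 1) * g θ *
      Complex.exp (2 * Complex.I * (r : ℂ) * (Real.cos θ : ℂ)))
      (Set.uIoc 0 R ×ˢ Set.uIoc 0 (2 * π)) := fun R => by
    have hr : IntegrableOn (fun r : ℝ => (r : ℂ) ^ (s - 1)) (Set.uIoc 0 R) :=
      intervalIntegrable_iff.1 (intervalIntegral.intervalIntegrable_cpow' (by simpa using h₁))
    have hθ : IntegrableOn g (Set.uIoc 0 (2 * π)) :=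
      intervalIntegrable_iff.1 (hgc.intervalIntegrable _ _)
    rw [IntegrableOn, Measure.volume_eq_prod, ← Measure.prod_restrict]
    refine (Integrable.mul_prod hr hθ).mul_bdd (c := 1)
      (Continuous.aestronglyMeasurable (by fun_prop)) (.of_forall fun p => ?_)
    simp [Complex.norm_exp]
  have hswap : ∀ R, (∫ r in (0:ℝ)..R, ∫ θ in (0:ℝ)..(2 * π), (r : ℂ) ^ (s - 1) * g θ *
      Complex.exp (2 * Complex.I * (r : ℂ) * (Real.cos θ : ℂ))) =
      ∫ θ in (0:ℝ)..(2 * π), g θ * oscMellin s (2 * cos θ) R := fun R => by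
    rw [intervalIntegral_intervalIntegral_swap (hint R)]
    refine intervalIntegral.integral_congr fun θ _ => ?_
    simp only [oscMellin, ← intervalIntegral.integral_const_mul, hexp]
    congr 1
    ext r
    ring
  refine ⟨∫ θ in (0:ℝ)..(2 * π), g θ * L (2 * cos θ), Tendsto.congr (fun R => (hswap R).symm) <|
    intervalIntegral.tendsto_integral_filter_of_dominated_convergence
      (fun θ => M * (C * (2 ^ (-s.re) * |cos θ| ^ (-s.re)))) (.of_forall fun R => ?_) ?_
      ((((intervalIntegrable_abs_cos_rpow h₁.le h₂' _ _).const_mul _).const_mul _).const_mul _) ?_⟩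
  · refine hgc.aestronglyMeasurable.mul ?_
    have hm : StronglyMeasurable fun p : ℝ × ℝ =>
        (p.2 : ℂ) ^ (s - 1) * Complex.exp (Complex.I * ((2 * cos p.1 : ℝ) : ℂ) * p.2) :=
      Measurable.stronglyMeasurable (by fun_prop)
    simp only [oscMellin, intervalIntegral]
    exact (hm.integral_prod_right'.sub hm.integral_prod_right').aestronglyMeasurable
  · filter_upwards [eventually_ge_atTop 0] with R hR
    filter_upwards [hcos] with θ hθ hmem
    rw [Set.uIoc_of_le hpi] at hmem
    have h := hC (2 * cos θ) (mul_ne_zero two_ne_zero hθ) R hR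
    rw [abs_mul, abs_two, mul_rpow (by norm_num) (abs_nonneg _)] at h
    rw [norm_mul]
    have hM' := hM θ ⟨hmem.1.le, hmem.2⟩
    exact mul_le_mul hM' h (norm_nonneg _) ((norm_nonneg _).trans hM')
  · filter_upwards [hcos] with θ hθ _
    exact (hL _ (mul_ne_zero two_ne_zero hθ)).const_mul _
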